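/- Let T₀ be the n×n upper-triangular Toeplitz complex matrix whose (i,j) entry equals t_{j−i+1} for j ≥ i and 0 otherwise, where λ := t₁ is real and t₂ ≠ 0. Let T := T₀ ⊕ conj(T₀) ∈ Ω_{2n} and B := T ⊕ conj(T). Then B is (Q_{2n} ⊕ Q_{2n})-selfadjoint, and there exists an invertible matrix S ∈ Ω_{4n} such that S⁻¹BS = J_n(λ) ⊕ J_n(λ) ⊕ J_n(λ) ⊕ J_n(λ) and S*(Q_{2n} ⊕ Q_{2n})S = Q_n ⊕ (−Q_n) ⊕ Q_n ⊕ (−Q_n). -/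

import Mathlib

open Matrix

noncomputable section

/-- The `k×k` upper-triangular Jordan block with eigenvalue `lam`. -/
def jordanBlock {R : Type*} [Zero R] [One R] (lam : R) (k : ℕ) : Matrix (Fin k) (Fin k) R :=
  Matrix.of fun i j => if (i : ℕ) = (j : ℕ) then lam else if (i : ℕ) + 1 = (j : ℕ) then 1 else 0

/-- The `k×k` sip matrix: ones on the main anti-diagonal, zeros elsewhere. -/
def sip (R : Type*) [Zero R] [One R] (k : ℕ) : Matrix (Fin k) (Fin k) R :=
  Matrix.of fun i j => if (i : ℕ) + (j : ℕ) = k - 1 then 1 else 0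

/-- The order-preserving identification of `Fin k ⊕ Fin k` with `Fin (2*k)`. -/
def finTwoMul (k : ℕ) : (Fin k ⊕ Fin k) ≃ Fin (2 * k) :=
  finSumFinEquiv.trans (finCongr (two_mul k).symm)

/-- Block-diagonal direct sum `M ⊕ N` of two `k×k` matrices, as a `(2k)×(2k)` matrix. -/
def dsum2 {R : Type*} [Zero R] {k : ℕ} (M N : Matrix (Fin k) (Fin k) R) :
    Matrix (Fin (2 * k)) (Fin (2 * k)) R :=
  Matrix.reindex (finTwoMul k) (finTwoMul k) (Matrix.fromBlocks M 0 0 N)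

/-- The `2n×2n` complex matrix `[[A₁, conj A₂], [−A₂, conj A₁]]`. -/
def omegaMap {n : ℕ} (A₁ A₂ : Matrix (Fin n) (Fin n) ℂ) :
    Matrix (Fin (2 * n)) (Fin (2 * n)) ℂ :=
  Matrix.reindex (finTwoMul n) (finTwoMul n)
    (Matrix.fromBlocks A₁ (A₂.map (starRingEnd ℂ)) (-A₂) (A₁.map (starRingEnd ℂ)))

/-- Membership in the real subalgebra `Ω_{2n}` of `2n×2n` complex matrices. -/
def InOmega {n : ℕ} (M : Matrix (Fin (2 * n)) (Fin (2 * n)) ℂ) : Prop :=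
  ∃ A₁ A₂ : Matrix (Fin n) (Fin n) ℂ, M = omegaMap A₁ A₂


/-- The `n×n` upper-triangular Toeplitz matrix whose `(i,j)` entry is `t (j−i+1)`
for `j ≥ i` (in 1-based numbering of the diagonals) and `0` otherwise. -/
def toeplitzUT (n : ℕ) (t : ℕ → ℂ) : Matrix (Fin n) (Fin n) ℂ :=
  Matrix.of fun i j => if (i : ℕ) ≤ (j : ℕ) then t ((j : ℕ) - (i : ℕ) + 1) else 0

section Blocks

variable {R : Type*} {k : ℕ}

/-- A `2×2` block matrix, indexed by `Fin (2 * k)`. -/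
def blocks2 (A B C D : Matrix (Fin k) (Fin k) R) : Matrix (Fin (2 * k)) (Fin (2 * k)) R :=
  Matrix.reindex (finTwoMul k) (finTwoMul k) (Matrix.fromBlocks A B C D)

theorem dsum2_eq_blocks2 [Zero R] (A D : Matrix (Fin k) (Fin k) R) :
    dsum2 A D = blocks2 A 0 0 D := rfl

theorem blocks2_mul [Semiring R] (A B C D A' B' C' D' : Matrix (Fin k) (Fin k) R) :
    blocks2 A B C D * blocks2 A' B' C' D' =
      blocks2 (A * A' + B * C') (A * B' + B * D') (C * A' + D * C') (C * B' + D * D') := by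
  simp [blocks2, Matrix.submatrix_mul_equiv, Matrix.fromBlocks_multiply]

theorem blocks2_conjTranspose [Star R] (A B C D : Matrix (Fin k) (Fin k) R) :
    (blocks2 A B C D)ᴴ = blocks2 Aᴴ Cᴴ Bᴴ Dᴴ := by
  simp [blocks2, Matrix.fromBlocks_conjTranspose]

theorem dsum2_mul [Semiring R] (A D A' D' : Matrix (Fin k) (Fin k) R) :
    dsum2 A D * dsum2 A' D' = dsum2 (A * A') (D * D') := by
  simp [dsum2_eq_blocks2, blocks2_mul]

theorem dsum2_conjTranspose [AddMonoid R] [StarAddMonoid R] (A D : Matrix (Fin k) (Fin k) R) :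
    (dsum2 A D)ᴴ = dsum2 Aᴴ Dᴴ := by
  simp [dsum2_eq_blocks2, blocks2_conjTranspose]

theorem dsum2_map {S : Type*} [Semiring R] [Semiring S] (f : R →+* S)
    (A D : Matrix (Fin k) (Fin k) R) : (dsum2 A D).map f = dsum2 (A.map f) (D.map f) := by
  simp [dsum2, ← Matrix.submatrix_map, Matrix.fromBlocks_map]

theorem dsum2_one [Zero R] [One R] :
    dsum2 (1 : Matrix (Fin k) (Fin k) R) 1 = 1 := by
  simp [dsum2]

theorem dsum2_mul_self_eq_one [Semiring R] {A D : Matrix (Fin k) (Fin k) R}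
    (hA : A * A = 1) (hD : D * D = 1) : dsum2 A D * dsum2 A D = 1 := by
  rw [dsum2_mul, hA, hD, dsum2_one]

end Blocks

section Sip

variable {R : Type*} {k : ℕ}

theorem sip_eq_submatrix [Zero R] [One R] :
    sip R k = (1 : Matrix (Fin k) (Fin k) R).submatrix Fin.revPerm (Equiv.refl _) := by
  ext i j
  simp only [sip, Matrix.of_apply, Matrix.submatrix_apply, Matrix.one_apply, Fin.ext_iff,
    Fin.revPerm_apply, Fin.val_rev, Equiv.refl_apply]
  congr 1
  simp only [eq_iff_iff]
  omega

theorem sip_mul_apply [Semiring R] (M : Matrix (Fin k) (Fin k) R) (i j : Fin k) :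
    (sip R k * M) i j = M i.rev j := by
  rw [sip_eq_submatrix, Matrix.one_submatrix_mul]
  simp

theorem mul_sip_apply [Semiring R] (M : Matrix (Fin k) (Fin k) R) (i j : Fin k) :
    (M * sip R k) i j = M i j.rev := by
  have h : sip R k = (1 : Matrix (Fin k) (Fin k) R).submatrix (Equiv.refl _) Fin.revPerm := by
    rw [sip_eq_submatrix]
    ext i j
    simp [Matrix.one_apply, Fin.rev_eq_iff]
  rw [h, Matrix.mul_submatrix_one]
  simp

theorem sip_mul_sip [Semiring R] : sip R k * sip R k = 1 := by
  ext i j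
  rw [sip_mul_apply]
  simp only [sip, Matrix.of_apply, Matrix.one_apply, Fin.ext_iff, Fin.val_rev]
  congr 1
  simp only [eq_iff_iff]
  omega

theorem sip_map {S : Type*} [Semiring R] [Semiring S] (f : R →+* S) :
    (sip R k).map f = sip S k := by
  ext i j
  simp [sip, apply_ite f]

theorem sip_conjTranspose [Semiring R] [StarRing R] : (sip R k)ᴴ = sip R k := by
  ext i j
  simp [sip, Matrix.conjTranspose_apply, apply_ite star, add_comm]

theorem sip_two_mul [Zero R] [One R] :
    sip R (2 * k) = blocks2 0 (sip R k) (sip R k) 0 := by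
  ext i j
  obtain ⟨i, rfl⟩ := (finTwoMul k).surjective i
  obtain ⟨j, rfl⟩ := (finTwoMul k).surjective j
  have hl (x : Fin k) : ((finTwoMul k (.inl x) : Fin (2 * k)) : ℕ) = x := by simp [finTwoMul]
  have hr (x : Fin k) : ((finTwoMul k (.inr x) : Fin (2 * k)) : ℕ) = k + x := by
    simp [finTwoMul, add_comm]
  rcases i with i | i <;> rcases j with j | j <;>
    simp only [blocks2, sip, Matrix.of_apply, hl, hr, Matrix.reindex_apply,
      Matrix.submatrix_apply, Equiv.symm_apply_apply, Matrix.fromBlocks_apply₁₁,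
      Matrix.fromBlocks_apply₁₂, Matrix.fromBlocks_apply₂₁, Matrix.fromBlocks_apply₂₂,
      Matrix.zero_apply] <;>
    grind

end Sip

theorem jordanBlock_map {R S : Type*} [Semiring R] [Semiring S] (f : R →+* S) (a : R) (k : ℕ) :
    (jordanBlock a k).map f = jordanBlock (f a) k := by
  ext i j
  simp [jordanBlock, apply_ite f]

theorem sip_mul_toeplitzUT_map_conj (n : ℕ) (t : ℕ → ℂ) :
    sip ℂ n * (toeplitzUT n t).map (starRingEnd ℂ) = (toeplitzUT n t)ᴴ * sip ℂ n := by
  ext i j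
  rw [sip_mul_apply, mul_sip_apply]
  simp only [toeplitzUT, Matrix.map_apply, Matrix.conjTranspose_apply, Matrix.of_apply,
    Fin.val_rev]
  have : n - (↑i + 1) ≤ (j : ℕ) ↔ n - (↑j + 1) ≤ (i : ℕ) := by omega
  have : (j : ℕ) - (n - (↑i + 1)) = i - (n - (↑j + 1)) := by omega
  simp_all

theorem jordanBlock_conjTranspose_mul_sip (n : ℕ) (a : ℝ) :
    (jordanBlock (a : ℂ) n)ᴴ * sip ℂ n = sip ℂ n * jordanBlock (a : ℂ) n := by
  ext i j
  rw [sip_mul_apply, mul_sip_apply]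
  simp only [jordanBlock, Matrix.conjTranspose_apply, Matrix.of_apply, Fin.val_rev]
  have h₁ : n - (↑i + 1) = (j : ℕ) ↔ n - (↑j + 1) = (i : ℕ) := by omega
  have h₂ : n - (↑i + 1) + 1 = (j : ℕ) ↔ n - (↑j + 1) + 1 = (i : ℕ) := by omega
  simp only [h₁, h₂, apply_ite star]
  simp

section JordanChain

variable {R : Type*} [CommRing R] {n : ℕ} {M : Matrix (Fin n) (Fin n) R}

theorem pow_apply_eq_zero_of_strictUpper (hM : ∀ i j, j ≤ i → M i j = 0) (k : ℕ) (i j : Fin n)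
    (h : (j : ℕ) < i + k) : (M ^ k) i j = 0 := by
  induction k generalizing i with
  | zero => exact Matrix.one_apply_ne (by rintro rfl; simp at h)
  | succ k ih =>
    rw [pow_succ', Matrix.mul_apply]
    refine Finset.sum_eq_zero fun l _ => ?_
    by_cases hl : l ≤ i
    · rw [hM i l hl, zero_mul]
    · rw [ih l (by omega), mul_zero]

theorem pow_apply_superdiagonal (hM : ∀ i j, j ≤ i → M i j = 0) {c : R}
    (hc : ∀ i j : Fin n, (i : ℕ) + 1 = j → M i j = c) (k : ℕ) (i j : Fin n)
    (h : (j : ℕ) = i + k) : (M ^ k) i j = c ^ k := by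
  induction k generalizing i with
  | zero =>
    obtain rfl : j = i := by ext; simpa using h
    simp
  | succ k ih =>
    have hi : (i : ℕ) + 1 < n := by omega
    rw [pow_succ', Matrix.mul_apply, Finset.sum_eq_single ⟨i + 1, hi⟩, hc _ _ rfl,
      ih ⟨i + 1, hi⟩ (by simp; omega), pow_succ']
    · intro l _ hl
      by_cases hli : l ≤ i
      · rw [hM i l hli, zero_mul]
      · have : (l : ℕ) ≠ i + 1 := fun h => hl (Fin.ext h)
        rw [pow_apply_eq_zero_of_strictUpper hM k l j (by omega), mul_zero]
    · simp

/-- A scalar plus a strictly upper triangular matrix whose superdiagonal entries all equal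
a unit is similar to a single Jordan block. -/
theorem exists_isUnit_mul_jordanBlock (hM : ∀ i j, j ≤ i → M i j = 0) {c : R} (hcu : IsUnit c)
    (hc : ∀ i j : Fin n, (i : ℕ) + 1 = j → M i j = c) (a : R) :
    ∃ X : Matrix (Fin n) (Fin n) R, IsUnit X ∧
      (Matrix.scalar (Fin n) a + M) * X = X * jordanBlock a n := by
  let X : Matrix (Fin n) (Fin n) R :=
    Matrix.of fun i j => (M ^ (n - 1 - (j : ℕ))) i ⟨n - 1, Nat.sub_lt j.pos one_pos⟩
  refine ⟨X, ?_, ?_⟩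
  · have hX : X.BlockTriangular id := fun i j hij =>
      pow_apply_eq_zero_of_strictUpper hM _ _ _ (by
        have : (j : ℕ) < i := hij
        simp only; omega)
    rw [Matrix.isUnit_iff_isUnit_det, Matrix.det_of_isUpperTriangular hX]
    refine (IsUnit.prod_univ_iff).2 fun i => ?_
    have : X i i = c ^ (n - 1 - (i : ℕ)) :=
      pow_apply_superdiagonal hM hc _ _ _ (by simp only; omega)
    rw [this]
    exact hcu.pow _
  · have hJ : jordanBlock a n = Matrix.scalar (Fin n) a + jordanBlock 0 n := by
      ext i j
      simp only [jordanBlock, Matrix.of_apply, Matrix.add_apply, Matrix.scalar_apply,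
        Matrix.diagonal_apply, Fin.ext_iff]
      split_ifs <;> simp
    have hMX : M * X = X * jordanBlock 0 n := by
      ext i j
      have hleft : (M * X) i j = (M ^ (n - 1 - (j : ℕ) + 1)) i ⟨n - 1, Nat.sub_lt j.pos one_pos⟩ := by
        rw [pow_succ', Matrix.mul_apply, Matrix.mul_apply]
        rfl
      rw [hleft, Matrix.mul_apply]
      by_cases hj : (j : ℕ) = 0
      · rw [pow_apply_eq_zero_of_strictUpper hM _ _ _ (by simp only; omega)]
        refine (Finset.sum_eq_zero fun l _ => ?_).symm
        simp [jordanBlock, hj]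
      · have hj' : (j : ℕ) - 1 < n := by omega
        rw [Finset.sum_eq_single ⟨j - 1, hj'⟩]
        · have h₁ : n - 1 - (j : ℕ) + 1 = n - 1 - (j - 1) := by omega
          have h₂ : (j : ℕ) - 1 + 1 = j := by omega
          have h₃ : (j : ℕ) - 1 ≠ j := by omega
          simp [jordanBlock, X, h₁, h₂, h₃]
        · intro l _ hl
          have : (l : ℕ) + 1 ≠ j := fun h => hl (Fin.ext (by simp only; omega))
          simp [jordanBlock, this]
        · simp
    rw [hJ, add_mul, mul_add, hMX, (Matrix.scalar_commute a (fun _ => Commute.all _ _) X).eq]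

end JordanChain

theorem exists_isUnit_toeplitzUT_mul (n : ℕ) {t : ℕ → ℂ} (h2 : t 2 ≠ 0) :
    ∃ X : Matrix (Fin n) (Fin n) ℂ, IsUnit X ∧
      toeplitzUT n t * X = X * jordanBlock (t 1) n := by
  obtain ⟨X, hX, h⟩ := exists_isUnit_mul_jordanBlock
    (M := toeplitzUT n t - Matrix.scalar (Fin n) (t 1)) (c := t 2) (n := n) (fun i j hij => by
      rcases hij.eq_or_lt with rfl | hij
      · simp [toeplitzUT]
      · simp [toeplitzUT, hij.ne', hij]) h2.isUnit (fun i j hij => by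
      have h₁ : i ≠ j := by rintro rfl; omega
      have h₂ : i ≤ j := by omega
      have h₃ : (j : ℕ) - i + 1 = 2 := by omega
      simp [toeplitzUT, h₁, h₂, h₃]) (t 1)
  exact ⟨X, hX, by simpa using h⟩

/-- The pair `(T₀ ⊕ conj T₀, Q)` is unitarily similar to `(J ⊕ J, Q ⊕ -Q)`. -/
theorem exists_toeplitz_reduction (n : ℕ) {t : ℕ → ℂ} {lam : ℝ} (h1 : t 1 = (lam : ℂ))
    (h2 : t 2 ≠ 0) :
    ∃ A : Matrix (Fin (2 * n)) (Fin (2 * n)) ℂ,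
      dsum2 (toeplitzUT n t) ((toeplitzUT n t).map (starRingEnd ℂ)) * A =
        A * dsum2 (jordanBlock (lam : ℂ) n) (jordanBlock (lam : ℂ) n) ∧
      Aᴴ * sip ℂ (2 * n) * A = dsum2 (sip ℂ n) (-sip ℂ n) := by
  obtain ⟨X, hX, hTX⟩ := exists_isUnit_toeplitzUT_mul n h2
  rw [h1] at hTX
  obtain ⟨Y, hXY, hYX⟩ := isUnit_iff_exists.1 hX
  set T := toeplitzUT n t
  set J := jordanBlock (lam : ℂ) n
  have hJ : Jᴴ * sip ℂ n = sip ℂ n * J := jordanBlock_conjTranspose_mul_sip n lam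
  have hT : sip ℂ n * T.map (starRingEnd ℂ) = Tᴴ * sip ℂ n := sip_mul_toeplitzUT_map_conj n t
  have hQ : sip ℂ n * sip ℂ n = 1 := sip_mul_sip
  have hYT : Y * T = J * Y := by
    calc Y * T = Y * (T * X) * Y := by simp [mul_assoc, hXY]
      _ = J * Y := by rw [hTX, ← mul_assoc, hYX, one_mul]
  set Z := (1 / 2 : ℂ) • (sip ℂ n * Yᴴ * sip ℂ n)
  have hTc : T.map (starRingEnd ℂ) = sip ℂ n * Tᴴ * sip ℂ n := by
    rw [mul_assoc, ← hT, ← mul_assoc, hQ, one_mul]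
  have hTZ : T.map (starRingEnd ℂ) * Z = Z * J := by
    have hYT' : Tᴴ * Yᴴ = Yᴴ * Jᴴ := by
      rw [← Matrix.conjTranspose_mul, hYT, Matrix.conjTranspose_mul]
    simp only [Z, Matrix.mul_smul, Matrix.smul_mul]
    congr 1
    calc T.map (starRingEnd ℂ) * (sip ℂ n * Yᴴ * sip ℂ n)
        = sip ℂ n * Tᴴ * (sip ℂ n * sip ℂ n) * Yᴴ * sip ℂ n := by rw [hTc]; simp only [mul_assoc]
      _ = sip ℂ n * (Tᴴ * Yᴴ) * sip ℂ n := by rw [hQ, mul_one]; simp only [mul_assoc]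
      _ = sip ℂ n * Yᴴ * (Jᴴ * sip ℂ n) := by rw [hYT']; simp only [mul_assoc]
      _ = sip ℂ n * Yᴴ * sip ℂ n * J := by rw [hJ]; simp only [mul_assoc]
  have hXZ : Xᴴ * (sip ℂ n * Z) = (1 / 2 : ℂ) • sip ℂ n := by
    have hXY' : Xᴴ * Yᴴ = 1 := by rw [← Matrix.conjTranspose_mul, hYX, Matrix.conjTranspose_one]
    simp only [Z, Matrix.mul_smul]
    congr 1
    calc Xᴴ * (sip ℂ n * (sip ℂ n * Yᴴ * sip ℂ n))
        = Xᴴ * (sip ℂ n * sip ℂ n) * Yᴴ * sip ℂ n := by simp only [mul_assoc]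
      _ = sip ℂ n := by rw [hQ, mul_one, hXY', one_mul]
  have hZX : Zᴴ * (sip ℂ n * X) = (1 / 2 : ℂ) • sip ℂ n := by
    have h := congrArg Matrix.conjTranspose hXZ
    simpa [Matrix.conjTranspose_mul, sip_conjTranspose, mul_assoc] using h
  have half (M : Matrix (Fin n) (Fin n) ℂ) : (1 / 2 : ℂ) • M + (1 / 2 : ℂ) • M = M := by
    rw [← add_smul]; norm_num
  refine ⟨blocks2 X X Z (-Z), ?_, ?_⟩
  · simp [dsum2_eq_blocks2, blocks2_mul, hTX, hTZ]
  · rw [sip_two_mul, blocks2_conjTranspose, mul_assoc, dsum2_eq_blocks2]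
    simp only [blocks2_mul, Matrix.conjTranspose_neg, zero_mul, mul_neg, neg_mul, zero_add,
      add_zero, neg_zero, hXZ, hZX, half, ← neg_add, neg_add_cancel, add_neg_cancel]

/-- **Lemma 3.5 (Lemma 2.12 recalled).** Let `T = T₀ ⊕ conj T₀ ∈ Ω_{2n}` where `T₀` is upper
triangular Toeplitz with real diagonal `λ = t₁` and `t₂ ≠ 0`, and let `B = T ⊕ conj T`. Then
`B` is `(Q_{2n} ⊕ Q_{2n})`-selfadjoint and `(B, Q_{2n} ⊕ Q_{2n})` is unitarily similar via an
invertible `S ∈ Ω_{4n}` to `(J_n(λ)⊕J_n(λ)⊕J_n(λ)⊕J_n(λ), Q_n ⊕ −Q_n ⊕ Q_n ⊕ −Q_n)`. -/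
theorem toeplitz_canonical {n : ℕ} (t : ℕ → ℂ) (lam : ℝ)
    (h1 : t 1 = (lam : ℂ)) (h2 : t 2 ≠ 0) :
    dsum2 (sip ℂ (2 * n)) (sip ℂ (2 * n)) *
        dsum2 (dsum2 (toeplitzUT n t) ((toeplitzUT n t).map (starRingEnd ℂ)))
          ((dsum2 (toeplitzUT n t) ((toeplitzUT n t).map (starRingEnd ℂ))).map
            (starRingEnd ℂ)) =
      (dsum2 (dsum2 (toeplitzUT n t) ((toeplitzUT n t).map (starRingEnd ℂ)))
          ((dsum2 (toeplitzUT n t) ((toeplitzUT n t).map (starRingEnd ℂ))).map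
            (starRingEnd ℂ)))ᴴ *
        dsum2 (sip ℂ (2 * n)) (sip ℂ (2 * n)) ∧
    ∃ S : Matrix (Fin (2 * (2 * n))) (Fin (2 * (2 * n))) ℂ,
      IsUnit S ∧ InOmega (n := 2 * n) S ∧
      S⁻¹ * dsum2 (dsum2 (toeplitzUT n t) ((toeplitzUT n t).map (starRingEnd ℂ)))
          ((dsum2 (toeplitzUT n t) ((toeplitzUT n t).map (starRingEnd ℂ))).map
            (starRingEnd ℂ)) * S =
        dsum2 (dsum2 (jordanBlock ((lam : ℂ)) n) (jordanBlock ((lam : ℂ)) n))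
          (dsum2 (jordanBlock ((lam : ℂ)) n) (jordanBlock ((lam : ℂ)) n)) ∧
      Sᴴ * dsum2 (sip ℂ (2 * n)) (sip ℂ (2 * n)) * S =
        dsum2 (dsum2 (sip ℂ n) (-sip ℂ n)) (dsum2 (sip ℂ n) (-sip ℂ n)) := by
  have hQT := sip_mul_toeplitzUT_map_conj n t
  obtain ⟨A, hTA, hAQ⟩ := exists_toeplitz_reduction n h1 h2
  set T := dsum2 (toeplitzUT n t) ((toeplitzUT n t).map (starRingEnd ℂ)) with hTdef
  set J := dsum2 (jordanBlock (lam : ℂ) n) (jordanBlock (lam : ℂ) n) with hJdef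
  set P := dsum2 (sip ℂ n) (-sip ℂ n) with hPdef
  have hmap_mul (M N : Matrix (Fin (2 * n)) (Fin (2 * n)) ℂ) :
      (M * N).map (starRingEnd ℂ) = M.map (starRingEnd ℂ) * N.map (starRingEnd ℂ) :=
    Matrix.map_mul
  have hmap_star (M : Matrix (Fin (2 * n)) (Fin (2 * n)) ℂ) :
      Mᴴ.map (starRingEnd ℂ) = (M.map (starRingEnd ℂ))ᴴ := by
    ext i j; simp
  have hself : sip ℂ (2 * n) * T = Tᴴ * sip ℂ (2 * n) := by
    have hQT' : sip ℂ n * toeplitzUT n t = ((toeplitzUT n t).map (starRingEnd ℂ))ᴴ * sip ℂ n := by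
      have h := congrArg Matrix.conjTranspose hQT
      simpa [Matrix.conjTranspose_mul, sip_conjTranspose] using h.symm
    rw [sip_two_mul, hTdef, dsum2_conjTranspose]
    simp [dsum2_eq_blocks2, blocks2_mul, hQT, hQT']
  have hselfc := congrArg (fun M => M.map (starRingEnd ℂ)) hself
  have hTAc := congrArg (fun M => M.map (starRingEnd ℂ)) hTA
  have hAQc := congrArg (fun M => M.map (starRingEnd ℂ)) hAQ
  have hJc : J.map (starRingEnd ℂ) = J := by
    rw [hJdef, dsum2_map, jordanBlock_map, Complex.conj_ofReal]
  have hPc : P.map (starRingEnd ℂ) = P := by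
    rw [hPdef, dsum2_map, Matrix.map_neg _ (map_neg _), sip_map]
  simp only [hmap_mul, hmap_star, sip_map, hJc, hPc] at hselfc hTAc hAQc
  have hPP : P * P = 1 := dsum2_mul_self_eq_one sip_mul_sip (by simp [sip_mul_sip])
  have hform : (dsum2 A (A.map (starRingEnd ℂ)))ᴴ * dsum2 (sip ℂ (2 * n)) (sip ℂ (2 * n)) *
      dsum2 A (A.map (starRingEnd ℂ)) = dsum2 P P := by
    rw [dsum2_conjTranspose, dsum2_mul, dsum2_mul, hAQ, hAQc]
  have hS : IsUnit (dsum2 A (A.map (starRingEnd ℂ))) :=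
    IsUnit.of_mul_eq_one_right (dsum2 P P * ((dsum2 A (A.map (starRingEnd ℂ)))ᴴ *
      dsum2 (sip ℂ (2 * n)) (sip ℂ (2 * n)))) (by
        rw [mul_assoc, hform, dsum2_mul_self_eq_one hPP hPP])
  refine ⟨?_, dsum2 A (A.map (starRingEnd ℂ)), hS, ⟨A, 0, ?_⟩, ?_, hform⟩
  · rw [dsum2_conjTranspose, dsum2_mul, dsum2_mul, hself, hselfc]
  · simp [omegaMap, dsum2]
  · rw [mul_assoc, dsum2_mul, hTA, hTAc, ← dsum2_mul, Matrix.nonsing_inv_mul_cancel_left _ _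
      ((Matrix.isUnit_iff_isUnit_det _).1 hS)]

end
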